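/- For every n, the number of λ-terms of natural size n equals the number of E₁-free black-white binary trees with black root having exactly n nodes. Equivalently, there is a size-preserving bijection between λ-terms (with the natural size) and E₁-free black-white binary trees with black root (with size = number of nodes). -/

import Mathlib

inductive Term : Type
  | idx : ℕ → Term
  | app : Term → Term → Term
  | abs : Term → Term

def Term.size : Term → ℕ
  | .idx n => n + 1
  | .app t u => t.size + u.size + 1
  | .abs t => t.size + 1

noncomputable def L (n : ℕ) : ℕ := Nat.card {t : Term // t.size = n}

-- E₁-free black-white binary trees: `BWb` has a black root, `BWw` a white root.
-- Allowed edges: black→(left)black, black→(left)white, white→(left)white,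
-- white→(right)black.
mutual
  inductive BWb : Type
    | leaf : BWb
    | leftB : BWb → BWb
    | leftW : BWw → BWb
  inductive BWw : Type
    | leaf : BWw
    | leftW : BWw → BWw
    | rightB : BWb → BWw
    | leftWrightB : BWw → BWb → BWw
end

mutual
  def BWb.size : BWb → ℕ
    | .leaf => 1
    | .leftB t => t.size + 1
    | .leftW t => t.size + 1
  def BWw.size : BWw → ℕ
    | .leaf => 1
    | .leftW t => t.size + 1
    | .rightB t => t.size + 1
    | .leftWrightB t u => t.size + u.size + 1
end

-- A white-rooted tree corresponds to an index or to the two arguments of an application.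
mutual
  def BWb.toTerm : BWb → Term
    | .leaf => .idx 0
    | .leftB b => .abs b.toTerm
    | .leftW w => match w.toShape with
      | .inl n => .idx (n + 1)
      | .inr (t, u) => .app t u
  def BWw.toShape : BWw → ℕ ⊕ Term × Term
    | .leaf => .inl 0
    | .leftW w => match w.toShape with
      | .inl n => .inl (n + 1)
      | .inr (t, u) => .inr (t, .abs u)
    | .rightB b => .inr (b.toTerm, .idx 0)
    | .leftWrightB w b => match w.toShape with
      | .inl n => .inr (b.toTerm, .idx (n + 1))
      | .inr (u, v) => .inr (b.toTerm, .app u v)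
end

def BWw.chain : ℕ → BWw
  | 0 => .leaf
  | n + 1 => .leftW (chain n)

-- `u.toWhite b` is the white-rooted tree of the application of the term of `b` to `u`.
mutual
  def Term.toBlack : Term → BWb
    | .idx 0 => .leaf
    | .idx (n + 1) => .leftW (BWw.chain n)
    | .abs t => .leftB t.toBlack
    | .app t u => .leftW (u.toWhite t.toBlack)
  def Term.toWhite : Term → BWb → BWw
    | .idx 0, b => .rightB b
    | .idx (n + 1), b => .leftWrightB (BWw.chain n) b
    | .abs u, b => .leftW (u.toWhite b)
    | .app u v, b => .leftWrightB (v.toWhite u.toBlack) b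
end

def BWw.ofShape : ℕ ⊕ Term × Term → BWw
  | .inl n => BWw.chain n
  | .inr (t, u) => u.toWhite t.toBlack

def shapeSize : ℕ ⊕ Term × Term → ℕ
  | .inl n => n + 1
  | .inr (t, u) => t.size + u.size

theorem BWw.toShape_chain (n : ℕ) : (BWw.chain n).toShape = .inl n := by
  induction n with
  | zero => simp [BWw.chain, BWw.toShape]
  | succ n ih => simp [BWw.chain, BWw.toShape, ih]

theorem Term.toTerm_toBlack_and_toShape_toWhite (t : Term) :
    t.toBlack.toTerm = t ∧ ∀ b, (t.toWhite b).toShape = .inr (b.toTerm, t) := by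
  induction t with
  | idx n =>
    cases n <;> simp [Term.toBlack, Term.toWhite, BWb.toTerm, BWw.toShape, BWw.toShape_chain]
  | app t u iht ihu =>
    simp [Term.toBlack, Term.toWhite, BWb.toTerm, BWw.toShape, iht.1, ihu.2]
  | abs t ih =>
    simp [Term.toBlack, Term.toWhite, BWb.toTerm, BWw.toShape, ih.1, ih.2]

mutual
  theorem BWb.toBlack_toTerm : (b : BWb) → b.toTerm.toBlack = b
    | .leaf => by simp [BWb.toTerm, Term.toBlack]
    | .leftB b => by simp [BWb.toTerm, Term.toBlack, BWb.toBlack_toTerm b]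
    | .leftW w => by
      have h := BWw.ofShape_toShape w
      rcases hw : w.toShape with n | ⟨t, u⟩ <;> rw [hw] at h <;>
        simpa [BWb.toTerm, Term.toBlack, hw, BWw.ofShape] using h
  theorem BWw.ofShape_toShape : (w : BWw) → BWw.ofShape w.toShape = w
    | .leaf => by simp [BWw.toShape, BWw.ofShape, BWw.chain]
    | .leftW w => by
      have h := BWw.ofShape_toShape w
      rcases hw : w.toShape with n | ⟨t, u⟩ <;> rw [hw] at h <;>
        simpa [BWw.toShape, Term.toWhite, hw, BWw.ofShape, BWw.chain] using h
    | .rightB b => by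
      simp [BWw.toShape, BWw.ofShape, Term.toWhite, BWb.toBlack_toTerm b]
    | .leftWrightB w b => by
      have h := BWw.ofShape_toShape w
      rcases hw : w.toShape with n | ⟨t, u⟩ <;> rw [hw] at h <;>
        simpa [BWw.toShape, Term.toWhite, hw, BWw.ofShape, BWb.toBlack_toTerm b] using h
end

mutual
  theorem BWb.size_toTerm : (b : BWb) → b.toTerm.size = b.size
    | .leaf => by simp [BWb.toTerm, BWb.size, Term.size]
    | .leftB b => by simp [BWb.toTerm, BWb.size, Term.size, BWb.size_toTerm b]
    | .leftW w => by
      have h := BWw.shapeSize_toShape w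
      rcases hw : w.toShape with n | ⟨t, u⟩ <;> rw [hw] at h <;>
        simp only [BWb.toTerm, BWb.size, Term.size, hw, shapeSize] at h ⊢ <;> omega
  theorem BWw.shapeSize_toShape : (w : BWw) → shapeSize w.toShape = w.size
    | .leaf => by simp [BWw.toShape, BWw.size, shapeSize]
    | .leftW w => by
      have h := BWw.shapeSize_toShape w
      rcases hw : w.toShape with n | ⟨t, u⟩ <;> rw [hw] at h <;>
        simp only [BWw.toShape, BWw.size, Term.size, hw, shapeSize] at h ⊢ <;> omega
    | .rightB b => by
      simp [BWw.toShape, BWw.size, shapeSize, Term.size, BWb.size_toTerm b]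
    | .leftWrightB w b => by
      have h := BWw.shapeSize_toShape w
      have hb := BWb.size_toTerm b
      rcases hw : w.toShape with n | ⟨t, u⟩ <;> rw [hw] at h <;>
        simp only [BWw.toShape, BWw.size, Term.size, hw, shapeSize] at h ⊢ <;> omega
end

def blackEquivTerm : BWb ≃ Term where
  toFun := BWb.toTerm
  invFun := Term.toBlack
  left_inv := BWb.toBlack_toTerm
  right_inv t := t.toTerm_toBlack_and_toShape_toWhite.1

theorem lambda_eq_blackwhite :
    ∀ n : ℕ, L n = Nat.card {t : BWb // t.size = n} := by
  intro n
  refine (Nat.card_congr (blackEquivTerm.subtypeEquiv fun b => ?_)).symm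
  rw [← BWb.size_toTerm b]
  rfl
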